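/- arXiv:2302.12543 — 2 statements merged into one kernel-verified Lean document; each statement's English description precedes it below -/
import Mathlib

section
/- Identify ℝ² with ℂ via z = x₁ + i x₂, let U ⊆ ℂ be open and connected, and let a₁, a₂ : U → ℝ be smooth; set A = a₁ + i a₂. Then the pair (a₁,a₂) satisfies the weak-stiffness equations ∂₁a₂ + ∂₂a₁ = 2 a₁ a₂ and ∂₁a₁ − a₁² = ∂₂a₂ − a₂² on U if and only if (∂₁ + i ∂₂)A = A² on U. Moreover, in that case either A ≡ 0 on U, or there exists a function f meromorphic on U such that: at every point z ∈ U at which f is analytic, z̄ + f(z) ≠ 0 and A(z) = −2/(z̄ + f(z)), and A(z₀) = 0 at every pole z₀ of f in U. Conversely, any A of either of these forms satisfies (∂₁ + i ∂₂)A = A². -/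
open ComplexConjugate

/-- `f` is real differentiable at `z`, and `(∂₁ + i∂₂) f = d` there. -/
def HasDbarAt (f : ℂ → ℂ) (d z : ℂ) : Prop :=
  ∃ f' : ℂ →L[ℝ] ℂ, HasFDerivAt f f' z ∧ f' 1 + Complex.I * f' Complex.I = d

namespace HasDbarAt

variable {f g : ℂ → ℂ} {d e z : ℂ}

theorem fderiv_eq (h : HasDbarAt f d z) :
    fderiv ℝ f z 1 + Complex.I * fderiv ℝ f z Complex.I = d := by
  obtain ⟨f', hf, rfl⟩ := h
  rw [hf.fderiv]

theorem of_fderiv (hf : DifferentiableAt ℝ f z)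
    (h : fderiv ℝ f z 1 + Complex.I * fderiv ℝ f z Complex.I = d) : HasDbarAt f d z :=
  ⟨_, hf.hasFDerivAt, h⟩

theorem of_differentiableAt (hf : DifferentiableAt ℂ f z) : HasDbarAt f 0 z := by
  refine ⟨_, hf.hasFDerivAt.restrictScalars ℝ, ?_⟩
  have h : fderiv ℂ f z Complex.I = Complex.I * fderiv ℂ f z 1 := by
    simp
  simp only [ContinuousLinearMap.coe_restrictScalars', h]
  linear_combination (fderiv ℂ f z 1) * Complex.I_mul_I

theorem differentiableAt (h : HasDbarAt f 0 z) : DifferentiableAt ℂ f z := by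
  have h0 := h.fderiv_eq
  obtain ⟨f', hf, -⟩ := h
  refine differentiableAt_complex_iff_differentiableAt_real.2 ⟨hf.differentiableAt, ?_⟩
  rw [smul_eq_mul]
  linear_combination (-Complex.I) * h0 + (fderiv ℝ f z Complex.I) * Complex.I_mul_I

theorem conj_id (z : ℂ) : HasDbarAt (fun w => conj w) 2 z := by
  refine ⟨_, Complex.conjCLE.hasFDerivAt, ?_⟩
  simp only [ContinuousLinearEquiv.coe_coe, Complex.conjCLE_apply, map_one, Complex.conj_I]
  linear_combination -Complex.I_mul_I

theorem add (hf : HasDbarAt f d z) (hg : HasDbarAt g e z) :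
    HasDbarAt (fun w => f w + g w) (d + e) z := by
  obtain ⟨f', hf, rfl⟩ := hf
  obtain ⟨g', hg, rfl⟩ := hg
  refine ⟨_, hf.add hg, ?_⟩
  simp only [_root_.add_apply]
  ring

theorem mul (hf : HasDbarAt f d z) (hg : HasDbarAt g e z) :
    HasDbarAt (fun w => f w * g w) (d * g z + f z * e) z := by
  obtain ⟨f', hf, rfl⟩ := hf
  obtain ⟨g', hg, rfl⟩ := hg
  refine ⟨_, hf.mul hg, ?_⟩
  simp only [_root_.add_apply, _root_.smul_apply, smul_eq_mul]
  ring

theorem inv (hf : HasDbarAt f d z) (h0 : f z ≠ 0) :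
    HasDbarAt (fun w => (f w)⁻¹) (-d / f z ^ 2) z := by
  obtain ⟨f', hf, rfl⟩ := hf
  refine ⟨_, ((hasDerivAt_inv h0).hasFDerivAt.restrictScalars ℝ).comp z hf, ?_⟩
  simp
  ring

theorem const (c z : ℂ) : HasDbarAt (fun _ => c) 0 z :=
  of_differentiableAt (differentiableAt_const c)

theorem congr_of_eventuallyEq (hf : HasDbarAt f d z) (h : g =ᶠ[nhds z] f) : HasDbarAt g d z := by
  obtain ⟨f', hf, rfl⟩ := hf
  exact ⟨f', hf.congr_of_eventuallyEq h, rfl⟩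

/-- The function `-2 / (conj z + f z)` solves `(∂₁ + i∂₂) A = A²` where `f` is holomorphic. -/
theorem neg_two_div_conj_add (hf : DifferentiableAt ℂ f z) (h0 : conj z + f z ≠ 0) :
    HasDbarAt (fun w => -2 / (conj w + f w)) ((-2 / (conj z + f z)) ^ 2) z := by
  convert (const (-2) z).mul (((conj_id z).add (of_differentiableAt hf)).inv h0) using 1
  · simp only [div_eq_mul_inv]
  · field_simp
    ring

end HasDbarAt

section Riccati

open Filter Topology

variable {A : ℂ → ℂ} {U : Set ℂ} {z₀ : ℂ}

/-- The gauge transform of a solution `A` of `(∂₁ + i∂₂) A = A²` that is holomorphic near `z₀`. -/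
noncomputable def riccatiTransform (A : ℂ → ℂ) (z₀ z : ℂ) : ℂ :=
  -A z * (2 + (conj z - conj z₀) * A z)⁻¹

theorem eventually_riccatiTransform_denom_ne_zero (hA : ContinuousAt A z₀) :
    ∀ᶠ z in 𝓝 z₀, 2 + (conj z - conj z₀) * A z ≠ 0 := by
  have h : ContinuousAt (fun z => 2 + (conj z - conj z₀) * A z) z₀ := by
    have := Complex.continuous_conj.continuousAt (x := z₀)
    fun_prop
  exact h.eventually_ne (by simp)

theorem analyticAt_riccatiTransform (hU : U ∈ 𝓝 z₀)
    (hA : ∀ z ∈ U, HasDbarAt A (A z ^ 2) z) : AnalyticAt ℂ (riccatiTransform A z₀) z₀ := by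
  rw [Complex.analyticAt_iff_eventually_differentiableAt]
  have hc : ContinuousAt A z₀ := by
    obtain ⟨f', hf, -⟩ := hA z₀ (mem_of_mem_nhds hU)
    exact hf.continuousAt
  filter_upwards [hU, eventually_riccatiTransform_denom_ne_zero hc] with z hz hne
  apply HasDbarAt.differentiableAt
  have hneg : HasDbarAt (fun w => -A w) (-A z ^ 2) z := by
    convert (HasDbarAt.const (-1) z).mul (hA z hz) using 1
    · simp
    · ring
  have hw : HasDbarAt (fun w => conj w - conj z₀) 2 z := by
    simpa [sub_eq_add_neg] using (HasDbarAt.conj_id z).add (HasDbarAt.const (-conj z₀) z)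
  convert hneg.mul (((HasDbarAt.const 2 z).add (hw.mul (hA z hz))).inv hne) using 1
  · rfl
  · field_simp
    ring

theorem riccatiTransform_eq_zero_iff {z : ℂ} (h : 2 + (conj z - conj z₀) * A z ≠ 0) :
    riccatiTransform A z₀ z = 0 ↔ A z = 0 := by
  simp [riccatiTransform, h]

theorem eventually_eq_zero_or_eventually_ne_zero_of_hasDbarAt_sq (hU : U ∈ 𝓝 z₀)
    (hA : ∀ z ∈ U, HasDbarAt A (A z ^ 2) z) :
    (∀ᶠ z in 𝓝 z₀, A z = 0) ∨ ∀ᶠ z in 𝓝[≠] z₀, A z ≠ 0 := by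
  obtain ⟨f', hf, -⟩ := hA z₀ (mem_of_mem_nhds hU)
  have hne := eventually_riccatiTransform_denom_ne_zero hf.continuousAt
  refine (analyticAt_riccatiTransform hU hA).eventually_eq_zero_or_eventually_ne_zero.imp ?_ ?_
  · intro h
    filter_upwards [h, hne] with z hz hz' using (riccatiTransform_eq_zero_iff hz').1 hz
  · intro h
    filter_upwards [h, hne.filter_mono nhdsWithin_le_nhds] with z hz hz'
    exact mt (riccatiTransform_eq_zero_iff hz').2 hz

theorem eqOn_zero_or_eventually_ne_zero_of_hasDbarAt_sq (hU : IsOpen U) (hconn : IsPreconnected U)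
    (hA : ∀ z ∈ U, HasDbarAt A (A z ^ 2) z) :
    (∀ z ∈ U, A z = 0) ∨ ∀ z₀ ∈ U, ∀ᶠ z in 𝓝[≠] z₀, A z ≠ 0 := by
  have key := fun z (hz : z ∈ U) =>
    eventually_eq_zero_or_eventually_ne_zero_of_hasDbarAt_sq (hU.mem_nhds hz) hA
  by_cases h : (U ∩ {z | ∀ᶠ w in 𝓝 z, A w = 0}).Nonempty
  · left
    have hsub : U ⊆ {z | ∀ᶠ w in 𝓝 z, A w = 0} := by
      refine hconn.subset_of_closure_inter_subset isOpen_setOfPred_eventually_nhds h ?_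
      rintro z ⟨hzc, hzU⟩
      by_contra hz
      have hne := (key z hzU).resolve_left hz
      rw [eventually_nhdsWithin_iff] at hne
      obtain ⟨w, hw, hwA⟩ := ((mem_closure_iff_frequently.1 hzc).and_eventually hne).exists
      refine hwA (fun hwz => ?_) hw.self_of_nhds
      obtain rfl := Set.mem_singleton_iff.1 hwz
      exact hz hw
    exact fun z hz => (hsub hz).self_of_nhds
  · right
    exact fun z hz => (key z hz).resolve_left fun hz' => h ⟨z, hz, hz'⟩

/-- Near any point, the holomorphic part of a solution is, up to a constant, the reciprocal of its
gauge transform. -/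
theorem eventually_neg_two_div_sub_conj_eq (hU : U ∈ 𝓝 z₀)
    (hA : ∀ z ∈ U, HasDbarAt A (A z ^ 2) z) (hne : ∀ᶠ z in 𝓝[≠] z₀, A z ≠ 0) :
    ∀ᶠ z in 𝓝 z₀, -2 / A z - conj z = (riccatiTransform A z₀ z)⁻¹ - conj z₀ := by
  obtain ⟨f', hf, -⟩ := hA z₀ (mem_of_mem_nhds hU)
  rw [eventually_nhdsWithin_iff] at hne
  filter_upwards [hne, eventually_riccatiTransform_denom_ne_zero hf.continuousAt] with z hz hd
  by_cases hzz : z = z₀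
  · subst hzz
    by_cases h0 : A z = 0
    · simp [riccatiTransform, h0]
    · simp [riccatiTransform]
      field_simp
  · have := hz hzz
    rw [riccatiTransform, mul_inv, inv_inv]
    field_simp
    ring

theorem not_continuousAt_inv_of_eventually_ne_zero {g : ℂ → ℂ} (hg : ContinuousAt g z₀)
    (h0 : g z₀ = 0) (hne : ∀ᶠ z in 𝓝[≠] z₀, g z ≠ 0) :
    ¬ ContinuousAt (fun z => (g z)⁻¹) z₀ := by
  intro hinv
  have h1 : Tendsto (fun z => g z * (g z)⁻¹) (𝓝[≠] z₀) (𝓝 0) := by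
    have := (hg.mul hinv).tendsto.mono_left (nhdsWithin_le_nhds (s := {z₀}ᶜ))
    rwa [Pi.mul_apply, h0, zero_mul] at this
  have h2 : Tendsto (fun z => g z * (g z)⁻¹) (𝓝[≠] z₀) (𝓝 1) :=
    tendsto_const_nhds.congr' (by filter_upwards [hne] with z hz using (mul_inv_cancel₀ hz).symm)
  exact zero_ne_one (tendsto_nhds_unique h1 h2)

theorem exists_meromorphicOn_of_hasDbarAt_sq (hU : IsOpen U)
    (hA : ∀ z ∈ U, HasDbarAt A (A z ^ 2) z) (hne : ∀ z₀ ∈ U, ∀ᶠ z in 𝓝[≠] z₀, A z ≠ 0) :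
    ∃ f : ℂ → ℂ, MeromorphicOn f U ∧
      (∀ z ∈ U, AnalyticAt ℂ f z → conj z + f z ≠ 0 ∧ A z = -2 / (conj z + f z)) ∧
      (∀ z ∈ U, ¬AnalyticAt ℂ f z → A z = 0) := by
  have hg := fun z (hz : z ∈ U) => analyticAt_riccatiTransform (hU.mem_nhds hz) hA
  have heq := fun z (hz : z ∈ U) =>
    eventually_neg_two_div_sub_conj_eq (hU.mem_nhds hz) hA (hne z hz)
  refine ⟨fun z => -2 / A z - conj z, fun z hz => ?_, fun z hz hf => ?_, fun z hz => ?_⟩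
  · refine ((hg z hz).meromorphicAt.inv.sub (MeromorphicAt.const (conj z) z)).congr ?_
    filter_upwards [(heq z hz).filter_mono nhdsWithin_le_nhds] with w hw using hw.symm
  · have h0 : A z ≠ 0 := by
      intro h0
      obtain ⟨f', hA', -⟩ := hA z hz
      refine not_continuousAt_inv_of_eventually_ne_zero (hg z hz).continuousAt
        (by simp [riccatiTransform, h0]) ?_ ?_
      · filter_upwards [hne z hz, (eventually_riccatiTransform_denom_ne_zero
          hA'.continuousAt).filter_mono nhdsWithin_le_nhds] with w hw hw'
        exact mt (riccatiTransform_eq_zero_iff hw').1 hw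
      · refine (hf.continuousAt.add (continuousAt_const (y := conj z))).congr ?_
        filter_upwards [heq z hz] with w hw
        simp [hw]
    refine ⟨by simp [h0], ?_⟩
    field_simp
    ring
  · contrapose!
    intro h0
    have hg0 : riccatiTransform A z z ≠ 0 := by simp [riccatiTransform, h0]
    exact (((hg z hz).inv hg0).sub analyticAt_const).congr
      (by filter_upwards [heq z hz] with w hw using hw.symm)

theorem fderiv_eq_sq_of_meromorphicOn (hU : IsOpen U) (hA : ContDiffOn ℝ 1 A U) {f : ℂ → ℂ}
    (hf : MeromorphicOn f U)
    (hAf : ∀ z ∈ U, AnalyticAt ℂ f z → conj z + f z ≠ 0 ∧ A z = -2 / (conj z + f z)) {z : ℂ}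
    (hz : z ∈ U) :
    fderiv ℝ A z 1 + Complex.I * fderiv ℝ A z Complex.I = A z ^ 2 := by
  have hreg : ∀ w ∈ U, AnalyticAt ℂ f w →
      fderiv ℝ A w 1 + Complex.I * fderiv ℝ A w Complex.I = A w ^ 2 := by
    intro w hw hfw
    rw [(hAf w hw hfw).2]
    refine ((HasDbarAt.neg_two_div_conj_add hfw.differentiableAt
      (hAf w hw hfw).1).congr_of_eventuallyEq ?_).fderiv_eq
    filter_upwards [hU.mem_nhds hw, hfw.eventually_analyticAt] with v hv hfv
    exact (hAf v hv hfv).2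
  have hd : ContinuousAt (fderiv ℝ A) z :=
    (hA.continuousOn_fderiv_of_isOpen hU le_rfl).continuousAt (hU.mem_nhds hz)
  have hAc : ContinuousAt A z := hA.continuousOn.continuousAt (hU.mem_nhds hz)
  have hl : ContinuousAt
      (fun w => fderiv ℝ A w 1 + Complex.I * fderiv ℝ A w Complex.I) z :=
    (hd.clm_apply continuousAt_const).add
      (continuousAt_const.mul (hd.clm_apply continuousAt_const))
  refine tendsto_nhds_unique_of_eventuallyEq
    (hl.tendsto.mono_left (nhdsWithin_le_nhds (s := {z}ᶜ)))
    ((hAc.pow 2).tendsto.mono_left nhdsWithin_le_nhds) ?_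
  filter_upwards [(hf z hz).eventually_analyticAt,
    (hU.mem_nhds hz |> mem_nhdsWithin_of_mem_nhds : U ∈ 𝓝[≠] z)] with w hw hwU
  exact hreg w hwU hw

end Riccati

/-- On a connected open set `U ⊆ ℂ`, with `A = a₁ + i a₂`, the weak-stiffness
equations `∂₁a₂ + ∂₂a₁ = 2a₁a₂` and `∂₁a₁ − a₁² = ∂₂a₂ − a₂²` are equivalent to
`(∂₁ + i∂₂)A = A²`; in that case either `A ≡ 0` on `U` or `A(z) = −2/(z̄ + f(z))`
for a meromorphic `f` on `U` (with `A = 0` at the poles of `f`), and conversely any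
such `A` satisfies `(∂₁ + i∂₂)A = A²` on `U`. -/
theorem stmt14 (U : Set ℂ) (hUopen : IsOpen U) (hUconn : IsConnected U)
    (a₁ a₂ : ℂ → ℝ) (ha₁ : ContDiffOn ℝ (⊤ : ℕ∞) a₁ U) (ha₂ : ContDiffOn ℝ (⊤ : ℕ∞) a₂ U)
    (A : ℂ → ℂ) (hA : ∀ z, A z = a₁ z + a₂ z * Complex.I) :
    ((∀ z ∈ U,
        fderiv ℝ a₂ z 1 + fderiv ℝ a₁ z Complex.I = 2 * a₁ z * a₂ z ∧
        fderiv ℝ a₁ z 1 - a₁ z ^ 2 = fderiv ℝ a₂ z Complex.I - a₂ z ^ 2) ↔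
      (∀ z ∈ U,
        fderiv ℝ A z 1 + Complex.I * fderiv ℝ A z Complex.I = A z ^ 2)) ∧
    ((∀ z ∈ U,
        fderiv ℝ A z 1 + Complex.I * fderiv ℝ A z Complex.I = A z ^ 2) ↔
      ((∀ z ∈ U, A z = 0) ∨
        ∃ f : ℂ → ℂ, MeromorphicOn f U ∧
          (∀ z ∈ U, AnalyticAt ℂ f z →
            conj z + f z ≠ 0 ∧ A z = -2 / (conj z + f z)) ∧
          (∀ z ∈ U, ¬AnalyticAt ℂ f z → A z = 0))) := by
  have hfun : A = fun z => (a₁ z : ℂ) + a₂ z * Complex.I := funext hA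
  have hsmooth : ContDiffOn ℝ 1 A U := by
    have h1 : ContDiffOn ℝ 1 (fun z => (a₁ z : ℂ)) U :=
      Complex.ofRealCLM.contDiff.comp_contDiffOn (ha₁.of_le (by exact_mod_cast le_top))
    have h2 : ContDiffOn ℝ 1 (fun z => (a₂ z : ℂ)) U :=
      Complex.ofRealCLM.contDiff.comp_contDiffOn (ha₂.of_le (by exact_mod_cast le_top))
    rw [hfun]
    exact h1.add (h2.mul contDiffOn_const)
  have hdiff : ∀ z ∈ U, DifferentiableAt ℝ A z := fun z hz =>
    (hsmooth.differentiableOn one_ne_zero).differentiableAt (hUopen.mem_nhds hz)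
  refine ⟨forall₂_congr fun z hz => ?_, fun h => ?_, ?_⟩
  · have h1 : DifferentiableAt ℝ a₁ z :=
      (ha₁.differentiableOn (by simp)).differentiableAt (hUopen.mem_nhds hz)
    have h2 : DifferentiableAt ℝ a₂ z :=
      (ha₂.differentiableOn (by simp)).differentiableAt (hUopen.mem_nhds hz)
    have hfd : ∀ v, fderiv ℝ A z v = fderiv ℝ a₁ z v + fderiv ℝ a₂ z v * Complex.I := by
      intro v
      have h := (Complex.ofRealCLM.hasFDerivAt.comp z h1.hasFDerivAt).add
        ((Complex.ofRealCLM.hasFDerivAt.comp z h2.hasFDerivAt).mul_const Complex.I)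
      have h' : HasFDerivAt A _ z := h.congr_of_eventuallyEq (.of_forall hA)
      rw [h'.fderiv]
      simp [mul_comm]
    rw [hfd, hfd, hA, Complex.ext_iff]
    simp [pow_two]
    constructor
    · rintro ⟨h, h'⟩
      constructor <;> linarith
    · rintro ⟨h, h'⟩
      constructor <;> linarith
  · have hdb : ∀ z ∈ U, HasDbarAt A (A z ^ 2) z := fun z hz =>
      .of_fderiv (hdiff z hz) (h z hz)
    exact (eqOn_zero_or_eventually_ne_zero_of_hasDbarAt_sq hUopen hUconn.isPreconnected hdb).imp
      id (exists_meromorphicOn_of_hasDbarAt_sq hUopen hdb)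
  · rintro (h | ⟨f, hf, hAf, -⟩) z hz
    · rw [h z hz]
      have h0 : HasDbarAt A 0 z := (HasDbarAt.const 0 z).congr_of_eventuallyEq
        (by filter_upwards [hUopen.mem_nhds hz] with w hw using h w hw)
      simpa using h0.fderiv_eq
    · exact fderiv_eq_sq_of_meromorphicOn hUopen hsmooth hf hAf hz
end

section
/- Let d ≥ 1, let q and q' be the standard quadratic forms of signatures (p,d−p) and (p',d−p') on ℝ^d, and let λ, λ' ∈ ℝ and α ∈ ℝ∖{0}. Suppose f : ℝ^d → ℝ^d is an affine map such that q'(f(x)) + λ' = α·(q(x) + λ) for all x in some nonempty open subset V of ℝ^d. Then: f(0) = 0, so f is linear; q'(f(x)) = α·q(x) for all x ∈ ℝ^d; λ' = α·λ; the identity q'(f(x)) + λ' = α(q(x)+λ) holds for all x ∈ ℝ^d; if α > 0 then p' = p and f is a linear similarity of ratio √α (i.e. q'∘f = (√α)² q); and if α < 0 then p' = d − p. -/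
/-- The sign `ε_i` of the standard quadratic form of signature `(p, d−p)`. -/
def eps (d p : ℕ) (i : Fin d) : ℝ := if (i : ℕ) < p then 1 else -1

/-- The standard quadratic form of signature `(p, d−p)` on `ℝ^d`. -/
def qf (d p : ℕ) (x : Fin d → ℝ) : ℝ := ∑ i, eps d p i * x i ^ 2

/-- The symmetric bilinear form polarizing `qf d p`. -/
def bf (d p : ℕ) (x y : Fin d → ℝ) : ℝ := ∑ i, eps d p i * (x i * y i)

lemma qf_add_smul (d p : ℕ) (x y : Fin d → ℝ) (t : ℝ) :
    qf d p (x + t • y) = qf d p x + 2 * t * bf d p x y + t ^ 2 * qf d p y := by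
  simp only [qf, bf, Finset.mul_sum, ← Finset.sum_add_distrib, Pi.add_apply, Pi.smul_apply,
    smul_eq_mul]
  exact Finset.sum_congr rfl fun i _ ↦ by ring

lemma eq_zero_of_bf_eq_zero (d p : ℕ) (x : Fin d → ℝ) (h : ∀ y, bf d p x y = 0) : x = 0 := by
  funext i
  have := h (Pi.single i 1)
  rw [bf, Finset.sum_eq_single i (fun j _ hj ↦ by simp [hj]) (by simp)] at this
  have he : eps d p i ≠ 0 := by unfold eps; split_ifs <;> norm_num
  simpa [he] using this

lemma coeffs_eq_zero_of_eventually {a b c : ℝ}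
    (h : ∀ᶠ t in nhds (0 : ℝ), a + b * t + c * t ^ 2 = 0) : a = 0 ∧ b = 0 ∧ c = 0 := by
  obtain ⟨ε, hε, hball⟩ := Metric.eventually_nhds_iff.1 h
  have h0 := @hball 0 (by simpa using hε)
  have h1 := @hball (ε / 2) (by
    rw [Real.dist_eq, sub_zero, abs_of_pos (by positivity)]; linarith)
  have h2 := @hball (-(ε / 2)) (by
    rw [Real.dist_eq, sub_zero, abs_neg, abs_of_pos (by positivity)]; linarith)
  have ha : a = 0 := by linarith
  have hb : b * ε = 0 := by linarith
  have hc : c * ε ^ 2 = 0 := by linarith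
  exact ⟨ha, by simpa [hε.ne'] using hb, by simpa [hε.ne'] using hc⟩

lemma weightedSumSquares_smul_eps (d p : ℕ) (α : ℝ) (x : Fin d → ℝ) :
    QuadraticMap.weightedSumSquares ℝ (fun i ↦ α * eps d p i) x = α * qf d p x := by
  rw [QuadraticMap.weightedSumSquares_apply, qf, Finset.mul_sum]
  exact Finset.sum_congr rfl fun i _ ↦ by rw [smul_eq_mul]; ring

lemma ncard_val_lt {d p : ℕ} (hp : p ≤ d) : {i : Fin d | (i : ℕ) < p}.ncard = p := by
  rw [Set.ncard_eq_toFinset_card', Set.toFinset_ofPred, Fin.card_filter_val_lt, min_eq_right hp]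

lemma eps_pos_iff {d p : ℕ} {i : Fin d} : 0 < eps d p i ↔ (i : ℕ) < p := by
  unfold eps; split_ifs with h <;> simp [h]

lemma eps_neg_iff {d p : ℕ} {i : Fin d} : eps d p i < 0 ↔ ¬ (i : ℕ) < p := by
  unfold eps; split_ifs with h <;> simp [h]

/-- Sylvester's law of inertia for a linear equivalence rescaling standard forms. -/
lemma eq_ncard_of_equiv {d p p' : ℕ} (hp' : p' ≤ d) {α : ℝ}
    (e : (Fin d → ℝ) ≃ₗ[ℝ] (Fin d → ℝ)) (he : ∀ x, qf d p' (e x) = α * qf d p x) :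
    p' = {i : Fin d | 0 < α * eps d p i}.ncard := by
  have hequiv : QuadraticMap.Equivalent
      (QuadraticMap.weightedSumSquares ℝ (fun i ↦ α * eps d p i))
      (QuadraticMap.weightedSumSquares ℝ (fun i ↦ 1 * eps d p' i)) :=
    ⟨⟨e, fun x ↦ by
      change QuadraticMap.weightedSumSquares ℝ _ (e x) = _
      rw [weightedSumSquares_smul_eps, weightedSumSquares_smul_eps, one_mul, he]⟩⟩
  rw [← QuadraticForm.sigPos_weightedSumSquares,
    QuadraticForm.sigPos_of_equiv_weightedSumSquares hequiv]
  simp only [one_mul, eps_pos_iff, ncard_val_lt hp']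

lemma eq_of_equiv_of_pos {d p p' : ℕ} (hp : p ≤ d) (hp' : p' ≤ d) {α : ℝ} (hα : 0 < α)
    (e : (Fin d → ℝ) ≃ₗ[ℝ] (Fin d → ℝ)) (he : ∀ x, qf d p' (e x) = α * qf d p x) :
    p' = p := by
  have h := eq_ncard_of_equiv hp' e he
  simpa only [mul_pos_iff_of_pos_left hα, eps_pos_iff, ncard_val_lt hp] using h

lemma eq_sub_of_equiv_of_neg {d p p' : ℕ} (hp : p ≤ d) (hp' : p' ≤ d) {α : ℝ} (hα : α < 0)
    (e : (Fin d → ℝ) ≃ₗ[ℝ] (Fin d → ℝ)) (he : ∀ x, qf d p' (e x) = α * qf d p x) :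
    p' = d - p := by
  have h := eq_ncard_of_equiv hp' e he
  have hset : {i : Fin d | 0 < α * eps d p i} = {i : Fin d | (i : ℕ) < p}ᶜ := by
    ext i
    simp only [Set.mem_ofPred_eq, Set.mem_compl_iff, ← eps_neg_iff, mul_pos_iff, hα, hα.not_gt,
      false_and, true_and, false_or]
  rwa [hset, Set.ncard_compl, ncard_val_lt hp, Nat.card_eq_fintype_card, Fintype.card_fin] at h

/-- An affine relation between standard quadratic forms on a nonempty open set is global. -/
lemma qf_affine_eq_of_isOpen {d p p' : ℕ} {lam lam' α : ℝ}
    (f : (Fin d → ℝ) →ᵃ[ℝ] (Fin d → ℝ))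
    {V : Set (Fin d → ℝ)} (hVopen : IsOpen V) (hVne : V.Nonempty)
    (hf : ∀ x ∈ V, qf d p' (f x) + lam' = α * (qf d p x + lam)) (x : Fin d → ℝ) :
    qf d p' (f x) + lam' = α * (qf d p x + lam) := by
  obtain ⟨v, hv⟩ := hVne
  have hline (t : ℝ) : f (v + t • (x - v)) = f v + t • f.linear (x - v) := by
    rw [add_comm v, ← vadd_eq_add, f.map_vadd, map_smul, vadd_eq_add, add_comm]
  have hcont : Continuous fun t : ℝ ↦ v + t • (x - v) := by fun_prop
  have hev : ∀ᶠ t in nhds (0 : ℝ), v + t • (x - v) ∈ V :=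
    hcont.continuousAt.eventually_mem (hVopen.mem_nhds (by simpa using hv))
  obtain ⟨ha, hb, hc⟩ := coeffs_eq_zero_of_eventually
    (a := qf d p' (f v) + lam' - α * (qf d p v + lam))
    (b := 2 * bf d p' (f v) (f.linear (x - v)) - α * (2 * bf d p v (x - v)))
    (c := qf d p' (f.linear (x - v)) - α * qf d p (x - v)) (hev.mono fun t ht ↦ by
      have := hf _ ht
      rw [hline, qf_add_smul, qf_add_smul] at this
      linear_combination this)
  have hx : v + (1 : ℝ) • (x - v) = x := by simp
  rw [← hx, hline, qf_add_smul, qf_add_smul]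
  linear_combination ha + hb + hc

/-- If an affine map `f` satisfies `q'(f(x)) + λ' = α(q(x) + λ)` on a nonempty open
set, then `f` is linear (fixes `0`), `q'∘f = α·q` everywhere, `λ' = α λ`, the
identity holds everywhere; if `α > 0` then the signatures agree and `f` is a linear
similarity of ratio `√α`, and if `α < 0` then `p' = d − p`. -/
theorem stmt16 (d p p' : ℕ) (hd : 1 ≤ d) (hp : p ≤ d) (hp' : p' ≤ d)
    (lam lam' α : ℝ) (hα : α ≠ 0)
    (f : (Fin d → ℝ) →ᵃ[ℝ] (Fin d → ℝ))
    (V : Set (Fin d → ℝ)) (hVopen : IsOpen V) (hVne : V.Nonempty)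
    (hf : ∀ x ∈ V, qf d p' (f x) + lam' = α * (qf d p x + lam)) :
    f 0 = 0 ∧
    (∀ x, qf d p' (f x) = α * qf d p x) ∧
    lam' = α * lam ∧
    (∀ x, qf d p' (f x) + lam' = α * (qf d p x + lam)) ∧
    (0 < α → p' = p ∧ ∀ x, qf d p' (f x) = Real.sqrt α ^ 2 * qf d p x) ∧
    (α < 0 → p' = d - p) := by
  have hglob := qf_affine_eq_of_isOpen f hVopen hVne hf
  have hfx (x : Fin d → ℝ) : f x = f 0 + f.linear x := by
    simpa [add_comm] using f.map_vadd 0 x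
  have hcoeff (x : Fin d → ℝ) := coeffs_eq_zero_of_eventually
    (a := qf d p' (f 0) + lam' - α * lam) (b := 2 * bf d p' (f 0) (f.linear x))
    (c := qf d p' (f.linear x) - α * qf d p x) (Filter.Eventually.of_forall fun t ↦ by
      have h := hglob (0 + t • x)
      have h0 : qf d p 0 = 0 := by simp [qf]
      have hb0 : bf d p 0 x = 0 := by simp [bf]
      rw [qf_add_smul, h0, hb0, zero_add, hfx, map_smul, qf_add_smul] at h
      linear_combination h)
  have hL (x : Fin d → ℝ) : qf d p' (f.linear x) = α * qf d p x :=
    sub_eq_zero.1 (hcoeff x).2.2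
  have hbf (x y : Fin d → ℝ) :
      bf d p' (f.linear x) (f.linear y) = α * bf d p x y := by
    have h := hL (x + (1 : ℝ) • y)
    rw [map_add, map_smul, qf_add_smul, qf_add_smul, hL, hL] at h
    linear_combination h / 2
  have hinj : Function.Injective f.linear := by
    rw [injective_iff_map_eq_zero]
    intro x hx
    refine eq_zero_of_bf_eq_zero d p x fun y ↦ ?_
    have h := hbf x y
    rw [hx] at h
    have hb0 : bf d p' 0 (f.linear y) = 0 := by simp [bf]
    simpa [hb0, hα] using h.symm
  let e := LinearEquiv.ofInjectiveEndo f.linear hinj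
  have he (x : Fin d → ℝ) : qf d p' (e x) = α * qf d p x := hL x
  have hf0 : f 0 = 0 := by
    refine eq_zero_of_bf_eq_zero d p' _ fun y ↦ ?_
    obtain ⟨x, rfl⟩ := LinearMap.surjective_of_injective hinj y
    simpa using (hcoeff x).2.1
  have hq (x : Fin d → ℝ) : qf d p' (f x) = α * qf d p x := by
    rw [hfx, hf0, zero_add, hL]
  refine ⟨hf0, hq, ?_, hglob, fun h ↦ ⟨eq_of_equiv_of_pos hp hp' h e he, fun x ↦ ?_⟩,
    fun h ↦ eq_sub_of_equiv_of_neg hp hp' h e he⟩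
  · have := hglob 0
    rw [hq] at this
    linear_combination this
  · rw [Real.sq_sqrt h.le, hq]
end
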